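/- Let X be a random variable with mean zero and finite variance σ² > 0, and let k = ∫_0^1 F_X^{-1}(x) Φ^{-1}(x) dx, where F_X^{-1} is the quantile function of X and Φ^{-1} is the standard normal quantile function. Then k ≥ 0, D(X) = 2σ² − 2σk (so in particular D(X) ≤ 2σ²), and D*(X) = σ² − k² = D(X) − D(X)²/(4σ²). -/

import Mathlib

open MeasureTheory ProbabilityTheory Filter
open scoped ENNReal NNReal

noncomputable section

/-- The Mallows `r`-distance between two probability measures on `ℝ`:
the infimum over couplings `π` of `(∫ |x - y|^r dπ)^(1/r)`, valued in `ℝ≥0∞`. -/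
def mallows (r : ℝ) (μ ν : Measure ℝ) : ℝ≥0∞ :=
  (⨅ π ∈ {π : Measure (ℝ × ℝ) | π.map Prod.fst = μ ∧ π.map Prod.snd = ν},
    ∫⁻ p, ENNReal.ofReal (|p.1 - p.2| ^ r) ∂π) ^ (1 / r)

/-- The (left-continuous) quantile function of a distribution function `F`. -/
def quantileFn (F : ℝ → ℝ) (u : ℝ) : ℝ := sInf {x | u ≤ F x}

lemma meas_le_lt {α : Type*} [MeasurableSpace α] {a b c d : α → ℝ} (ha : Measurable a)
    (hb : Measurable b) (hc : Measurable c) (hd : Measurable d) :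
    MeasurableSet {x | a x ≤ b x ∧ c x < d x} :=
  (measurableSet_le ha hb).inter (measurableSet_lt hc hd)

lemma sq_as_area (x y : ℝ) : ENNReal.ofReal ((x - y) ^ 2) =
    ∫⁻ q : ℝ × ℝ, ({q : ℝ × ℝ | x ≤ min q.1 q.2 ∧ max q.1 q.2 < y}.indicator 1 q +
      {q : ℝ × ℝ | y ≤ min q.1 q.2 ∧ max q.1 q.2 < x}.indicator 1 q) := by
  have key : ∀ a b : ℝ, {q : ℝ × ℝ | a ≤ min q.1 q.2 ∧ max q.1 q.2 < b}
      = Set.Ico a b ×ˢ Set.Ico a b := by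
    intro a b; ext q; simp; tauto
  have hm : ∀ a b : ℝ, MeasurableSet (Set.Ico a b ×ˢ Set.Ico a b) := fun a b =>
    measurableSet_Ico.prod measurableSet_Ico
  rw [key, key, lintegral_add_left (measurable_one.indicator (hm _ _)),
    lintegral_indicator_one (hm _ _), lintegral_indicator_one (hm _ _)]
  rw [Measure.volume_eq_prod, Measure.prod_prod, Measure.prod_prod]
  simp only [Real.volume_Ico]
  rcases le_total x y with h | h
  · rw [ENNReal.ofReal_of_nonpos (sub_nonpos.2 h), mul_zero, add_zero,
      ← ENNReal.ofReal_mul (sub_nonneg.2 h)]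
    congr 1; ring
  · rw [ENNReal.ofReal_of_nonpos (sub_nonpos.2 h), mul_zero, zero_add,
      ← ENNReal.ofReal_mul (sub_nonneg.2 h)]
    congr 1; ring

lemma cost_as_area (π : Measure (ℝ × ℝ)) [IsProbabilityMeasure π] :
    ∫⁻ p, ENNReal.ofReal ((p.1 - p.2) ^ 2) ∂π =
    ∫⁻ q : ℝ × ℝ, (π {p | p.1 ≤ min q.1 q.2 ∧ max q.1 q.2 < p.2} +
      π {p | p.2 ≤ min q.1 q.2 ∧ max q.1 q.2 < p.1}) := by
  simp_rw [sq_as_area]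
  have hA : MeasurableSet {r : (ℝ × ℝ) × (ℝ × ℝ) |
      r.1.1 ≤ min r.2.1 r.2.2 ∧ max r.2.1 r.2.2 < r.1.2} :=
    meas_le_lt (by fun_prop) (by fun_prop) (by fun_prop) (by fun_prop)
  have hB : MeasurableSet {r : (ℝ × ℝ) × (ℝ × ℝ) |
      r.1.2 ≤ min r.2.1 r.2.2 ∧ max r.2.1 r.2.2 < r.1.1} :=
    meas_le_lt (by fun_prop) (by fun_prop) (by fun_prop) (by fun_prop)
  rw [lintegral_lintegral_swap]
  · refine lintegral_congr fun q => ?_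
    have h1 : MeasurableSet {p : ℝ × ℝ | p.1 ≤ min q.1 q.2 ∧ max q.1 q.2 < p.2} :=
      meas_le_lt (by fun_prop) (by fun_prop) (by fun_prop) (by fun_prop)
    have h2 : MeasurableSet {p : ℝ × ℝ | p.2 ≤ min q.1 q.2 ∧ max q.1 q.2 < p.1} :=
      meas_le_lt (by fun_prop) (by fun_prop) (by fun_prop) (by fun_prop)
    rw [← lintegral_indicator_one h1, ← lintegral_indicator_one h2,
      ← lintegral_add_left (measurable_one.indicator h1)]
    rfl
  · exact (((measurable_one (α := ℝ≥0∞)).indicator hA).add (measurable_one.indicator hB)).aemeasurable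

lemma como_bound (l : Measure ℝ) [IsProbabilityMeasure l] (S : Set ℝ) (hS : ∀ᵐ u ∂l, u ∈ S)
    (f g : ℝ → ℝ) (hf : MonotoneOn f S) (hg : MonotoneOn g S)
    (hgm : AEMeasurable g l) (a b : ℝ) :
    l {u | f u ≤ a ∧ b < g u} ≤ l {u | f u ≤ a} - l {u | g u ≤ b} := by
  by_cases h : ∃ u ∈ S, f u ≤ a ∧ b < g u
  · obtain ⟨u, hu, hua, hub⟩ := h
    have hsub : ∀ v ∈ S, g v ≤ b → f v ≤ a := by
      intro v hv hvb
      have : v ≤ u := by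
        by_contra hc
        have := hg hu hv (not_le.1 hc).le
        linarith
      exact (hf hv hu this).trans hua
    have hnull : NullMeasurableSet {u | g u ≤ b} l := hgm.nullMeasurable measurableSet_Iic
    have hd : l ({u | f u ≤ a ∧ b < g u}) + l {u | g u ≤ b} ≤ l {u | f u ≤ a} := by
      rw [← measure_union₀ hnull]
      · refine measure_mono_ae ?_
        filter_upwards [hS] with v hv hh
        rcases hh with hh | hh
        · exact hh.1
        · exact hsub v hv hh
      · refine Disjoint.aedisjoint (Set.disjoint_left.2 ?_)
        rintro v ⟨_, h1⟩ h2
        exact absurd h2 (not_le.2 h1)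
    exact ENNReal.le_sub_of_add_le_right (measure_ne_top _ _) hd
  · have : l {u | f u ≤ a ∧ b < g u} = 0 := by
      push Not at h
      rw [measure_eq_zero_iff_ae_notMem]
      filter_upwards [hS] with v hv hh
      exact absurd hh.2 (not_lt.2 (h v hv hh.1))
    rw [this]; exact zero_le

lemma coup_bound (π : Measure (ℝ × ℝ)) (X Y : ℝ × ℝ → ℝ) (a b : ℝ) :
    π {p | X p ≤ a} - π {p | Y p ≤ b} ≤ π {p | X p ≤ a ∧ b < Y p} := by
  rw [tsub_le_iff_right]
  refine le_trans (measure_mono ?_) (measure_union_le _ _)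
  intro p hp
  by_cases h : Y p ≤ b
  · exact Or.inr h
  · exact Or.inl ⟨hp, not_le.1 h⟩

lemma como_opt (l : Measure ℝ) [IsProbabilityMeasure l] (S : Set ℝ) (hS : ∀ᵐ u ∂l, u ∈ S)
    (f g : ℝ → ℝ) (hf : MonotoneOn f S) (hg : MonotoneOn g S)
    (hfm : AEMeasurable f l) (hgm : AEMeasurable g l) (π : Measure (ℝ × ℝ))
    (h1 : π.map Prod.fst = l.map f) (h2 : π.map Prod.snd = l.map g) :
    ∫⁻ u, ENNReal.ofReal ((f u - g u) ^ 2) ∂l ≤ ∫⁻ p, ENNReal.ofReal ((p.1 - p.2) ^ 2) ∂π := by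
  have hπ : IsProbabilityMeasure π := by
    constructor
    have : (π.map Prod.fst) Set.univ = 1 := by
      rw [h1, Measure.map_apply_of_aemeasurable hfm MeasurableSet.univ]; simp
    rwa [Measure.map_apply measurable_fst MeasurableSet.univ, Set.preimage_univ] at this
  have hfg : AEMeasurable (fun u => (f u, g u)) l := hfm.prodMk hgm
  have hπ' : IsProbabilityMeasure (l.map (fun u => (f u, g u))) :=
    Measure.isProbabilityMeasure_map hfg
  have e1 : ∫⁻ u, ENNReal.ofReal ((f u - g u) ^ 2) ∂l =
      ∫⁻ p, ENNReal.ofReal ((p.1 - p.2) ^ 2) ∂(l.map (fun u => (f u, g u))) := by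
    rw [lintegral_map' (by fun_prop) hfg]
  rw [e1, cost_as_area, cost_as_area]
  have hF : ∀ a, l {u | f u ≤ a} = π {p | p.1 ≤ a} := fun a => by
    have := congrArg (fun m => m (Set.Iic a)) h1
    simp only [Measure.map_apply measurable_fst measurableSet_Iic,
      Measure.map_apply_of_aemeasurable hfm measurableSet_Iic] at this
    exact this.symm
  have hG : ∀ a, l {u | g u ≤ a} = π {p | p.2 ≤ a} := fun a => by
    have := congrArg (fun m => m (Set.Iic a)) h2
    simp only [Measure.map_apply measurable_snd measurableSet_Iic,
      Measure.map_apply_of_aemeasurable hgm measurableSet_Iic] at this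
    exact this.symm
  refine lintegral_mono fun q => ?_
  have m1 : MeasurableSet {p : ℝ × ℝ | p.1 ≤ min q.1 q.2 ∧ max q.1 q.2 < p.2} :=
    meas_le_lt (by fun_prop) (by fun_prop) (by fun_prop) (by fun_prop)
  have m2 : MeasurableSet {p : ℝ × ℝ | p.2 ≤ min q.1 q.2 ∧ max q.1 q.2 < p.1} :=
    meas_le_lt (by fun_prop) (by fun_prop) (by fun_prop) (by fun_prop)
  rw [Measure.map_apply_of_aemeasurable hfg m1, Measure.map_apply_of_aemeasurable hfg m2]
  refine add_le_add ?_ ?_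
  · refine (como_bound l S hS f g hf hg hgm _ _).trans ?_
    rw [hF, hG]
    exact coup_bound π Prod.fst Prod.snd _ _
  · refine (como_bound l S hS g f hg hf hfm _ _).trans ?_
    rw [hF, hG]
    exact coup_bound π Prod.snd Prod.fst _ _

lemma mallows_como (l : Measure ℝ) [IsProbabilityMeasure l] (S : Set ℝ) (hS : ∀ᵐ u ∂l, u ∈ S)
    (f g : ℝ → ℝ) (hf : MonotoneOn f S) (hg : MonotoneOn g S)
    (hfm : AEMeasurable f l) (hgm : AEMeasurable g l) :
    mallows 2 (l.map f) (l.map g) ^ 2 = ∫⁻ u, ENNReal.ofReal ((f u - g u) ^ 2) ∂l := by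
  have hfg : AEMeasurable (fun u => (f u, g u)) l := hfm.prodMk hgm
  unfold mallows
  rw [← ENNReal.rpow_natCast, ← ENNReal.rpow_mul]
  norm_num
  apply le_antisymm
  · refine iInf_le_of_le (l.map (fun u => (f u, g u))) (iInf_le_of_le ⟨?_, ?_⟩ ?_)
    · rw [AEMeasurable.map_map_of_aemeasurable (by fun_prop) hfg]; rfl
    · rw [AEMeasurable.map_map_of_aemeasurable (by fun_prop) hfg]; rfl
    · rw [lintegral_map' (by fun_prop) hfg]
  · refine le_iInf fun π => le_iInf fun h => ?_
    exact como_opt l S hS f g hf hg hfm hgm π h.1 h.2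

/-- Lebesgue measure on the open unit interval. -/
def unifM : Measure ℝ := volume.restrict (Set.Ioo (0:ℝ) 1)

instance : IsProbabilityMeasure unifM := ⟨by simp [unifM]⟩

lemma unifM_ae : ∀ᵐ u ∂unifM, u ∈ Set.Ioo (0:ℝ) 1 := ae_restrict_mem measurableSet_Ioo

lemma quantile_galois (μ : Measure ℝ) [IsProbabilityMeasure μ] {u : ℝ} (hu : u ∈ Set.Ioo (0:ℝ) 1)
    (x : ℝ) : quantileFn (cdf μ) u ≤ x ↔ u ≤ cdf μ x := by
  have hne : {x | u ≤ cdf μ x}.Nonempty := by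
    have := ((tendsto_cdf_atTop μ).eventually (lt_mem_nhds hu.2)).exists
    obtain ⟨y, hy⟩ := this
    exact ⟨y, hy.le⟩
  obtain ⟨y, hy⟩ := ((tendsto_cdf_atBot μ).eventually (gt_mem_nhds hu.1)).exists
  have hbdd : BddBelow {x | u ≤ cdf μ x} := by
    refine ⟨y, fun z hz => ?_⟩
    by_contra hc
    have := monotone_cdf μ (not_le.1 hc).le
    exact absurd (lt_of_le_of_lt this hy) (not_lt.2 hz)
  constructor
  · intro h
    have hr := (cdf μ).right_continuous x
    have ht : Tendsto (cdf μ) (nhdsWithin x (Set.Ioi x)) (nhds (cdf μ x)) :=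
      hr.mono_left (nhdsWithin_mono _ Set.Ioi_subset_Ici_self)
    refine ge_of_tendsto ht ?_
    filter_upwards [self_mem_nhdsWithin] with z hz
    obtain ⟨w, hw, hwz⟩ := exists_lt_of_csInf_lt hne (lt_of_le_of_lt h hz)
    exact le_trans hw (monotone_cdf μ hwz.le)
  · intro h
    exact csInf_le hbdd h

lemma quantile_mono (μ : Measure ℝ) [IsProbabilityMeasure μ] :
    MonotoneOn (quantileFn (cdf μ)) (Set.Ioo (0:ℝ) 1) := by
  intro u hu v hv huv
  rw [quantile_galois μ hu]
  exact huv.trans ((quantile_galois μ hv _).1 le_rfl)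

lemma quantile_meas (μ : Measure ℝ) [IsProbabilityMeasure μ] :
    AEMeasurable (quantileFn (cdf μ)) unifM :=
  aemeasurable_restrict_of_monotoneOn measurableSet_Ioo (quantile_mono μ)

lemma quantile_map (μ : Measure ℝ) [IsProbabilityMeasure μ] :
    unifM.map (quantileFn (cdf μ)) = μ := by
  have := Measure.isProbabilityMeasure_map (quantile_meas μ)
  refine Measure.ext_of_Iic _ _ fun a => ?_
  rw [Measure.map_apply_of_aemeasurable (quantile_meas μ) measurableSet_Iic, ← ofReal_cdf μ a]
  have h1 : unifM (quantileFn (cdf μ) ⁻¹' Set.Iic a) = unifM (Set.Iic (cdf μ a)) := by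
    refine measure_congr ?_
    filter_upwards [unifM_ae] with u hu
    exact propext (quantile_galois μ hu a)
  rw [h1, unifM, Measure.restrict_congr_set Ioo_ae_eq_Ioc, Measure.restrict_apply measurableSet_Iic]
  have : Set.Iic (cdf μ a) ∩ Set.Ioc 0 1 = Set.Ioc 0 (cdf μ a) := by
    ext z
    have := cdf_le_one μ a
    simp only [Set.mem_inter_iff, Set.mem_Iic, Set.mem_Ioc]
    constructor
    · rintro ⟨h, h', _⟩; exact ⟨h', h⟩
    · rintro ⟨h, h'⟩; exact ⟨h', h, h'.trans this⟩
  rw [this, Real.volume_Ioc, sub_zero]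

lemma mallows_gauss (μ : Measure ℝ) [IsProbabilityMeasure μ] (m t : ℝ) (ht : 0 ≤ t) (s : ℝ≥0)
    (hs : (s : ℝ) = t ^ 2) :
    mallows 2 μ (gaussianReal m s) ^ 2 = ∫⁻ u, ENNReal.ofReal
      ((quantileFn (cdf μ) u - (m + t * quantileFn (cdf (gaussianReal 0 1)) u)) ^ 2) ∂unifM := by
  have hz := quantile_meas (gaussianReal 0 1)
  have h2 : unifM.map (fun u => m + t * quantileFn (cdf (gaussianReal 0 1)) u)
      = gaussianReal m s := by
    have e : (fun u => m + t * quantileFn (cdf (gaussianReal 0 1)) u) =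
      (fun x => m + x) ∘ ((fun x => t * x) ∘ (quantileFn (cdf (gaussianReal 0 1)))) := rfl
    rw [e, ← AEMeasurable.map_map_of_aemeasurable (by fun_prop) (by fun_prop),
      ← AEMeasurable.map_map_of_aemeasurable (by fun_prop) hz, quantile_map,
      gaussianReal_map_const_mul, gaussianReal_map_const_add]
    congr 1
    · ring
    · ext; simp [hs]
  have := mallows_como unifM (Set.Ioo 0 1) unifM_ae (quantileFn (cdf μ))
    (fun u => m + t * quantileFn (cdf (gaussianReal 0 1)) u) (quantile_mono μ)
    (fun u hu v hv huv => by
      have := quantile_mono (gaussianReal 0 1) hu hv huv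
      dsimp only
      gcongr) (quantile_meas μ) (by fun_prop)
  rwa [h2, quantile_map] at this

/-- **del Barrio-type identities.**  For a mean-zero `X` with variance `σ² > 0`, and
`k = ∫₀¹ F_X⁻¹(x) Φ⁻¹(x) dx`, one has `k ≥ 0`, `D(X) = 2σ² − 2σk` (so `D(X) ≤ 2σ²`),
and `D*(X) = σ² − k² = D(X) − D(X)²/(4σ²)`, where `D(X) = d₂²(X, Z_{0,σ²})` and
`D*(X) = inf_{m,s²} d₂²(X, Z_{m,s²})`. -/
theorem delBarrio_identities
    {Ω : Type*} [MeasureSpace Ω] [IsProbabilityMeasure (ℙ : Measure Ω)]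
    (X : Ω → ℝ) (hX : Measurable X)
    (σ : ℝ) (hσ : 0 < σ) (hmean : ℙ[X] = 0) (hvar : variance X ℙ = σ ^ 2)
    (k : ℝ)
    (hk : k = ∫ x in Set.Ioo (0:ℝ) 1,
      quantileFn (cdf ((ℙ : Measure Ω).map X)) x *
        quantileFn (cdf (gaussianReal 0 1)) x)
    (D : ℝ)
    (hD : D = (mallows 2 ((ℙ : Measure Ω).map X)
      (gaussianReal 0 ⟨σ ^ 2, sq_nonneg σ⟩) ^ 2).toReal)
    (Dstar : ℝ)
    (hDstar : Dstar = (⨅ (m : ℝ) (s : ℝ≥0),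
      mallows 2 ((ℙ : Measure Ω).map X) (gaussianReal m s) ^ 2).toReal) :
    0 ≤ k ∧ D = 2 * σ ^ 2 - 2 * σ * k ∧ D ≤ 2 * σ ^ 2 ∧
      Dstar = σ ^ 2 - k ^ 2 ∧ Dstar = D - D ^ 2 / (4 * σ ^ 2) := by
  have hμ : IsProbabilityMeasure ((ℙ : Measure Ω).map X) :=
    Measure.isProbabilityMeasure_map hX.aemeasurable
  have hXL : MemLp X 2 (ℙ : Measure Ω) := by
    rw [← evariance_lt_top_iff_memLp hX.aestronglyMeasurable]
    by_contra hc
    have : variance X ℙ = 0 := by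
      rw [variance, top_le_iff.1 (not_lt.1 hc)]; rfl
    rw [this] at hvar
    have := pow_pos hσ 2
    linarith
  have hX2 : ∫ ω, X ω ^ 2 ∂(ℙ : Measure Ω) = σ ^ 2 := by
    rw [← hvar, variance_of_integral_eq_zero hX.aemeasurable hmean]
  set μ := (ℙ : Measure Ω).map X with hμdef
  set Q := quantileFn (cdf μ) with hQ
  set z := quantileFn (cdf (gaussianReal 0 1)) with hz
  have hQm : AEMeasurable Q unifM := quantile_meas μ
  have hzm : AEMeasurable z unifM := quantile_meas _
  have hQmap : unifM.map Q = μ := quantile_map μ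
  have hzmap : unifM.map z = gaussianReal 0 1 := quantile_map _
  have hQL : MemLp Q 2 unifM := by
    have : MemLp id 2 μ := by
      rw [hμdef, memLp_map_measure_iff (by fun_prop) hX.aemeasurable]; exact hXL
    rw [← hQmap, memLp_map_measure_iff (by fun_prop) hQm] at this
    exact this
  have hzL : MemLp z 2 unifM := by
    have : MemLp id 2 (gaussianReal 0 1) := memLp_id_gaussianReal 2
    rw [← hzmap, memLp_map_measure_iff (by fun_prop) hzm] at this
    exact this
  have iQ1 : ∫ u, Q u ∂unifM = 0 := by
    have h : ∫ x, x ∂(unifM.map Q) = ∫ x, x ∂((ℙ : Measure Ω).map X) := by rw [hQmap]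
    rwa [integral_map hQm (by fun_prop), integral_map hX.aemeasurable (by fun_prop), hmean] at h
  have iQ2 : ∫ u, Q u ^ 2 ∂unifM = σ ^ 2 := by
    have h : ∫ x, x ^ 2 ∂(unifM.map Q) = ∫ x, x ^ 2 ∂((ℙ : Measure Ω).map X) := by rw [hQmap]
    rwa [integral_map hQm (by fun_prop), integral_map hX.aemeasurable (by fun_prop), hX2] at h
  have iz1 : ∫ u, z u ∂unifM = 0 := by
    have h : ∫ x, x ∂(unifM.map z) = ∫ x, x ∂(gaussianReal 0 1) := by rw [hzmap]
    rwa [integral_map hzm (by fun_prop), integral_id_gaussianReal] at h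
  have iz2 : ∫ u, z u ^ 2 ∂unifM = 1 := by
    have h : ∫ x, x ^ 2 ∂(unifM.map z) = ∫ x, x ^ 2 ∂(gaussianReal 0 1) := by rw [hzmap]
    have hv : variance (fun x => x) (gaussianReal 0 1) = ((1 : ℝ≥0) : ℝ) :=
      variance_fun_id_gaussianReal
    rw [variance_of_integral_eq_zero (by fun_prop) integral_id_gaussianReal] at hv
    rw [integral_map hzm (by fun_prop), hv] at h
    simpa using h
  have hk' : ∫ u, Q u * z u ∂unifM = k := hk.symm
  have nQ1 : Integrable Q unifM := hQL.integrable (by norm_num)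
  have nz1 : Integrable z unifM := hzL.integrable (by norm_num)
  have nQ2 : Integrable (fun u => Q u ^ 2) unifM := hQL.integrable_sq
  have nz2 : Integrable (fun u => z u ^ 2) unifM := hzL.integrable_sq
  have nQz : Integrable (fun u => Q u * z u) unifM := hQL.integrable_mul hzL
  -- the cost of the monotone coupling
  have cost : ∀ m t : ℝ, Integrable (fun u => (Q u - (m + t * z u)) ^ 2) unifM ∧
      ∫ u, (Q u - (m + t * z u)) ^ 2 ∂unifM = σ ^ 2 + m ^ 2 + t ^ 2 - 2 * t * k := by
    intro m t
    have e : (fun u => (Q u - (m + t * z u)) ^ 2) = fun u =>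
        Q u ^ 2 + (m ^ 2 + (t ^ 2 * z u ^ 2 + ((-2 * m) * Q u + ((2 * m * t) * z u +
          (-2 * t) * (Q u * z u))))) := by
      funext u; ring
    have i5 := nQz.const_mul (-2 * t)
    have i4 := (nz1.const_mul (2 * m * t)).fun_add i5
    have i3 := (nQ1.const_mul (-2 * m)).fun_add i4
    have i2 := (nz2.const_mul (t ^ 2)).fun_add i3
    have i1 := (integrable_const (μ := unifM) (m ^ 2)).fun_add i2
    rw [e]
    refine ⟨nQ2.add i1, ?_⟩
    rw [integral_add nQ2 i1, integral_add (integrable_const _) i2,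
      integral_add (nz2.const_mul (t ^ 2)) i3, integral_add (nQ1.const_mul (-2 * m)) i4,
      integral_add (nz1.const_mul (2 * m * t)) i5]
    simp only [integral_const_mul, iQ1, iQ2, iz1, iz2, hk']
    simp
    ring
  have hmal : ∀ (m t : ℝ) (s : ℝ≥0), 0 ≤ t → (s : ℝ) = t ^ 2 →
      mallows 2 μ (gaussianReal m s) ^ 2 =
        ENNReal.ofReal (σ ^ 2 + m ^ 2 + t ^ 2 - 2 * t * k) := by
    intro m t s ht hs
    rw [mallows_gauss μ m t ht s hs, ← (cost m t).2,
      ofReal_integral_eq_lintegral_ofReal (cost m t).1 (ae_of_all _ fun u => sq_nonneg _)]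
  have hnn : ∀ m t : ℝ, 0 ≤ σ ^ 2 + m ^ 2 + t ^ 2 - 2 * t * k := by
    intro m t
    rw [← (cost m t).2]
    exact integral_nonneg fun u => sq_nonneg _
  have hk0 : 0 ≤ k := by
    have h1 : ∀ v ∈ Set.Ioo (0:ℝ) 1, 0 ≤ k + Q v * z v := by
      intro v hv
      have hc : ∫ u, (Q u - Q v) * (z u - z v) ∂unifM = k + Q v * z v := by
        have e : (fun u => (Q u - Q v) * (z u - z v)) = fun u =>
            Q u * z u + ((-z v) * Q u + ((-Q v) * z u + Q v * z v)) := by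
          funext u; ring
        have i3 := (nz1.const_mul (-Q v)).fun_add (integrable_const (μ := unifM) (Q v * z v))
        have i2 := (nQ1.const_mul (-z v)).fun_add i3
        rw [e, integral_add nQz i2, integral_add (nQ1.const_mul (-z v)) i3,
          integral_add (nz1.const_mul (-Q v)) (integrable_const _)]
        simp only [integral_const_mul, iQ1, iz1, hk']
        simp
      rw [← hc]
      refine integral_nonneg_of_ae ?_
      filter_upwards [unifM_ae] with u hu
      rcases le_total u v with h | h
      · exact mul_nonneg_of_nonpos_of_nonpos (sub_nonpos.2 (quantile_mono μ hu hv h))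
          (sub_nonpos.2 (quantile_mono _ hu hv h))
      · exact mul_nonneg (sub_nonneg.2 (quantile_mono μ hv hu h))
          (sub_nonneg.2 (quantile_mono _ hv hu h))
    have h2 : 0 ≤ ∫ v, (k + Q v * z v) ∂unifM := by
      refine integral_nonneg_of_ae ?_
      filter_upwards [unifM_ae] with u hu using h1 u hu
    rw [integral_add (integrable_const _) nQz, hk'] at h2
    simp at h2
    linarith
  have hDv : D = 2 * σ ^ 2 - 2 * σ * k := by
    have h0 := hmal 0 σ ⟨σ ^ 2, sq_nonneg σ⟩ hσ.le rfl
    rw [hD.trans (congrArg ENNReal.toReal h0), ENNReal.toReal_ofReal (hnn 0 σ)]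
    ring
  have hDs : Dstar = σ ^ 2 - k ^ 2 := by
    have hinf : (⨅ (m : ℝ) (s : ℝ≥0), mallows 2 μ (gaussianReal m s) ^ 2)
        = ENNReal.ofReal (σ ^ 2 - k ^ 2) := by
      apply le_antisymm
      · refine iInf_le_of_le 0 (iInf_le_of_le ⟨k ^ 2, sq_nonneg k⟩ ?_)
        refine (hmal 0 k ⟨k ^ 2, sq_nonneg k⟩ hk0 rfl).le.trans ?_
        refine ENNReal.ofReal_le_ofReal (le_of_eq (by ring))
      · refine le_iInf fun m => le_iInf fun s => ?_
        rw [hmal m (Real.sqrt s) s (Real.sqrt_nonneg _) (Real.sq_sqrt s.2).symm]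
        refine ENNReal.ofReal_le_ofReal ?_
        nlinarith [sq_nonneg m, sq_nonneg (Real.sqrt s - k)]
    rw [hDstar, hinf, ENNReal.toReal_ofReal]
    have := hnn 0 k
    nlinarith
  refine ⟨hk0, hDv, ?_, hDs, ?_⟩
  · have := mul_nonneg hσ.le hk0
    rw [hDv]; linarith
  · rw [hDs, hDv]
    field_simp
    ring
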